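/- arXiv:cs/0502041 — 6 statements merged into one kernel-verified Lean document; each statement's English description precedes it below -/
import Mathlib

section
/- There exists a constant C > 0 such that for all integers a ≥ 1, b ≥ 1, and u ≥ 4 with a + b ≤ u, there exists a nonempty family 𝕊 of subsets of {1, 2, …, u} with log₂|𝕊| ≤ C·(log₂ log₂ u + log₂ C(a+b, a)) such that for every pair of disjoint sets A, B ⊆ {1, 2, …, u} with |A| ≤ a and |B| ≤ b, there exists S ∈ 𝕊 satisfying A ⊆ S and B ∩ S = ∅. -/
open Finset in
theorem greedy_cover {Ω P : Type*} [DecidableEq Ω] [DecidableEq P] [Fintype Ω] (R : Ω → P → Prop)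
    [∀ w p, Decidable (R w p)]
    (Q : Finset P) (D : ℝ) (hD : 1 ≤ D)
    (h : ∀ p ∈ Q, (Fintype.card Ω : ℝ) ≤ D * ((univ.filter (fun w => R w p)).card : ℝ))
    (hΩ : 0 < Fintype.card Ω) (t : ℕ) :
    ∃ T : Finset Ω, T.card ≤ t ∧
      (((Q.filter (fun p => ∀ w ∈ T, ¬ R w p)).card : ℝ) ≤ Q.card * (1 - 1 / D) ^ t) := by
  have hD0 : 0 < D := by linarith
  have hq : 0 ≤ 1 - 1 / D := by
    rw [sub_nonneg, div_le_one hD0]; exact hD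
  induction t with
  | zero => exact ⟨∅, by simp, by simp⟩
  | succ t ih =>
    obtain ⟨T, hT, hc⟩ := ih
    set V := Q.filter (fun p => ∀ w ∈ T, ¬ R w p) with hV
    -- averaging
    have hex : ∃ w : Ω, (V.card : ℝ) / D ≤ ((V.filter (fun p => R w p)).card : ℝ) := by
      by_contra hcon
      push Not at hcon
      have hne : (univ : Finset Ω).Nonempty := by
        rw [← card_pos]; simpa using hΩ
      have h1 : ∑ w : Ω, ((V.filter (fun p => R w p)).card : ℝ) < ∑ w : Ω, (V.card : ℝ) / D :=
        sum_lt_sum_of_nonempty hne (fun w _ => hcon w)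
      have h2 : ∑ w : Ω, ((V.filter (fun p => R w p)).card : ℝ)
          = ∑ p ∈ V, ((univ.filter (fun w => R w p)).card : ℝ) := by
        have := sum_card_bipartiteAbove_eq_sum_card_bipartiteBelow (s := (univ : Finset Ω)) (t := V) R
        unfold bipartiteAbove bipartiteBelow at this
        exact_mod_cast this
      have h3 : ∑ p ∈ V, ((Fintype.card Ω : ℝ) / D)
          ≤ ∑ p ∈ V, ((univ.filter (fun w => R w p)).card : ℝ) := by
        apply sum_le_sum
        intro p hp
        rw [div_le_iff₀ hD0, mul_comm]
        exact h p (mem_filter.1 hp).1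
      rw [h2] at h1
      simp only [sum_const, nsmul_eq_mul, card_univ] at h1 h3
      have : (V.card : ℝ) * (Fintype.card Ω / D) = Fintype.card Ω * (V.card / D) := by ring
      linarith
    obtain ⟨w, hw⟩ := hex
    refine ⟨insert w T, (card_insert_le _ _).trans (by omega), ?_⟩
    have h4 : Q.filter (fun p => ∀ w' ∈ insert w T, ¬ R w' p) = V.filter (fun p => ¬ R w p) := by
      ext p
      simp only [hV, mem_filter, mem_insert, forall_eq_or_imp]
      tauto
    rw [h4]
    have h5 : ((V.filter (fun p => R w p)).card : ℝ) + ((V.filter (fun p => ¬ R w p)).card : ℝ)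
        = V.card := by exact_mod_cast card_filter_add_card_filter_not (s := V) (fun p => R w p)
    have h6 : (V.card : ℝ) * (1 - 1 / D) ≤ Q.card * (1 - 1 / D) ^ t * (1 - 1 / D) :=
      mul_le_mul_of_nonneg_right hc hq
    have h7 : (V.card : ℝ) * (1 - 1 / D) = V.card - V.card / D := by ring
    rw [pow_succ, ← mul_assoc]
    linarith

theorem le_choose_aux (a b : ℕ) (ha : 1 ≤ a) (hb : 1 ≤ b) : a + b ≤ (a + b).choose a := by
  induction b, hb using Nat.le_induction with
  | base => simp
  | succ b hb ih =>
    obtain ⟨c, rfl⟩ : ∃ c, a = c + 1 := ⟨a - 1, by omega⟩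
    rw [← add_assoc, Nat.choose_succ_succ]
    have : 0 < (c + 1 + b).choose c := Nat.choose_pos (by omega)
    simp only [Nat.succ_eq_add_one] at *
    omega

theorem term_le_max (a b k : ℕ) (hb : 1 ≤ b) (hk : k ≤ a + b) :
    a ^ k * b ^ (a + b - k) * (a + b).choose k ≤ a ^ a * b ^ b * (a + b).choose a := by
  have key : ∀ k, k < a + b → ∃ X : ℕ, 
      a ^ (k+1) * b ^ (a + b - (k+1)) * (a + b).choose (k+1) * ((k+1) * b) = X * ((a + b - k) * a)
      ∧ a ^ k * b ^ (a + b - k) * (a + b).choose k = X := by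
    intro k hk
    refine ⟨_, ?_, rfl⟩
    have h1 := Nat.choose_succ_right_eq (a + b) k
    have h2 : a + b - k = (a + b - (k+1)) + 1 := by omega
    have h3 : b ^ (a + b - k) = b ^ (a + b - (k+1)) * b := by rw [h2, pow_succ]
    rw [h3, pow_succ]
    calc _ = a ^ k * a * b ^ (a + b - (k + 1)) * b * ((a + b).choose (k + 1) * (k + 1)) := by ring
      _ = _ := by rw [h1]; ring
  rcases le_total k a with h | h
  · -- increasing up to a
    induction h using Nat.decreasingInduction with
    | self => simp
    | of_succ k hka ih =>
      refine le_trans ?_ (ih (by omega))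
      obtain ⟨X, h1, h2⟩ := key k (by omega)
      rw [h2]
      have h3 : (k+1) * b ≤ (a + b - k) * a := by
        obtain ⟨c, rfl⟩ : ∃ c, a = k + 1 + c := ⟨a - (k+1), by omega⟩
        have : k + 1 + c + b - k = 1 + c + b := by omega
        rw [this]; nlinarith [Nat.zero_le (c*b), Nat.zero_le ((1+c)*(k+1+c))]
      have h4 : 0 < (k+1) * b := by positivity
      refine Nat.le_of_mul_le_mul_right ?_ h4
      rw [h1]
      exact Nat.mul_le_mul_left _ h3
  · induction k, h using Nat.le_induction with
    | base => simp
    | succ k hka ih =>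
      refine le_trans ?_ (ih (by omega))
      obtain ⟨X, h1, h2⟩ := key k (by omega)
      rw [h2]
      have h3 : (a + b - k) * a ≤ (k+1) * b := by
        obtain ⟨c, rfl⟩ : ∃ c, k = a + c := ⟨k - a, by omega⟩
        have : a + b - (a + c) ≤ b := by omega
        calc _ ≤ b * a := Nat.mul_le_mul_right _ this
          _ ≤ _ := by nlinarith [Nat.zero_le (c*b)]
      have h4 : 0 < (k+1) * b := by positivity
      refine Nat.le_of_mul_le_mul_right ?_ h4
      rw [h1]
      exact Nat.mul_le_mul_left _ h3

theorem pow_le_choose (a b : ℕ) (hb : 1 ≤ b) :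
    (a + b) ^ (a + b) ≤ (a + b + 1) * (a + b).choose a * (a ^ a * b ^ b) := by
  rw [add_pow]
  calc _ ≤ ∑ k ∈ Finset.range (a + b + 1), a ^ a * b ^ b * (a + b).choose a := by
        apply Finset.sum_le_sum
        intro k hk
        rw [Finset.mem_range] at hk
        simpa using term_le_max a b k hb (by omega)
    _ = _ := by simp; ring

/-- The set determined by a colouring. -/
def colSet (a n : ℕ) (U : Finset ℕ) (f : U → Fin n) : Finset ℕ :=
  (Finset.univ.filter (fun x : U => (f x : ℕ) < a)).map (Function.Embedding.subtype _)

open Finset in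
theorem count_col (a b : ℕ) (U A B : Finset ℕ) (hA : A ⊆ U) (hB : B ⊆ U) (hAB : Disjoint A B)
    (hAc : A.card = a) (hBc : B.card = b) :
    a ^ a * b ^ b * (a + b) ^ (U.card - (a + b)) ≤
      (univ.filter (fun f : U → Fin (a + b) =>
        A ⊆ colSet a (a + b) U f ∧ Disjoint B (colSet a (a + b) U f))).card := by
  let g : ℕ → Finset (Fin (a + b)) := fun x =>
    if x ∈ A then univ.filter (fun i => (i : ℕ) < a) else
    if x ∈ B then univ.filter (fun i => ¬ (i : ℕ) < a) else univ
  have c1 : (univ.filter (fun i : Fin (a + b) => (i : ℕ) < a)).card = a := by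
    rw [Fin.card_filter_val_lt]; omega
  have c2 : (univ.filter (fun i : Fin (a + b) => ¬ (i : ℕ) < a)).card = b := by
    have := card_filter_add_card_filter_not (s := (univ : Finset (Fin (a + b)))) (fun i => (i : ℕ) < a)
    rw [c1, card_univ, Fintype.card_fin] at this
    omega
  have hcard : (Fintype.piFinset (fun x : U => g x)).card
      = a ^ a * b ^ b * (a + b) ^ (U.card - (a + b)) := by
    rw [Fintype.card_piFinset, prod_coe_sort U (fun x => (g x).card)]
    have hU : U = (A ∪ B) ∪ (U \ (A ∪ B)) := by
      rw [union_sdiff_of_subset (union_subset hA hB)]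
    have hABc : (A ∪ B).card = a + b := by rw [card_union_of_disjoint hAB, hAc, hBc]
    rw [hU, prod_union disjoint_sdiff, prod_union hAB, ← hU]
    congr 1
    · congr 1
      · refine (prod_eq_pow_card (b := a) ?_).trans (by rw [hAc])
        intro x hx
        simp only [g, hx, if_true]; exact c1
      · refine (prod_eq_pow_card (b := b) ?_).trans (by rw [hBc])
        intro x hx
        have : x ∉ A := fun h => (disjoint_left.1 hAB h hx)
        simp only [g, hx, this, if_true, if_false]; exact c2
    · refine (prod_eq_pow_card (b := a + b) ?_).trans
        (by rw [card_sdiff_of_subset (union_subset hA hB), hABc])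
      intro x hx
      simp only [mem_sdiff, mem_union, not_or] at hx
      simp only [g, hx.2.1, hx.2.2, if_false]
      simp
  rw [← hcard]
  apply card_le_card
  intro f hf
  rw [Fintype.mem_piFinset] at hf
  rw [mem_filter]
  refine ⟨mem_univ _, ?_, ?_⟩
  · intro x hx
    have := hf ⟨x, hA hx⟩
    simp only [g, hx, if_true, mem_filter] at this
    simp only [colSet, mem_map, mem_filter]
    exact ⟨⟨x, hA hx⟩, ⟨mem_univ _, this.2⟩, rfl⟩
  · rw [disjoint_left]
    intro x hx hx'
    simp only [colSet, mem_map, mem_filter] at hx'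
    obtain ⟨y, ⟨_, hy⟩, rfl⟩ := hx'
    have := hf y
    have hn : (y : ℕ) ∉ A := fun h => (disjoint_left.1 hAB h hx)
    have hx2 : (y : ℕ) ∈ B := hx
    simp only [g, hn, hx2, if_true, if_false, mem_filter] at this
    exact this.2 hy

theorem numeric (c n L u : ℝ) (hn : 2 ≤ n) (hc : n ≤ c) (hL : 2 ≤ L) (hu : Real.log u ≤ L)
    (hu0 : 0 ≤ Real.log u) :
    ((⌈(n + 1) * c * (n * Real.log u)⌉₊ + 1 : ℕ) : ℝ) ≤ c ^ 5 * L := by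
  have h0 : 0 ≤ (n + 1) * c * (n * Real.log u) := by
    apply mul_nonneg
    · nlinarith
    · apply mul_nonneg <;> linarith
  have h1 := (Nat.ceil_lt_add_one h0).le
  push_cast
  have h2 : (n + 1) * c * (n * Real.log u) ≤ (2 * c) * c * (c * L) := by
    have hc0 : 0 ≤ c := by linarith
    have hn0 : 0 ≤ n := by linarith
    have hcc : 0 ≤ 2 * c * c := by positivity
    gcongr
    linarith
  have h3 : 8 ≤ c ^ 3 := by
    have : (2:ℝ) ^ 3 ≤ c ^ 3 := by gcongr; linarith
    linarith
  have h4 : 16 ≤ c ^ 3 * L := by nlinarith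
  have h5 : c ^ 5 * L = c ^ 2 * (c ^ 3 * L) := by ring
  have h6 : 4 ≤ c ^ 2 := by nlinarith
  have h7 : 4 * (c ^ 3 * L) ≤ c ^ 2 * (c ^ 3 * L) := by gcongr
  have h8 : (2 * c) * c * (c * L) = 2 * (c ^ 3 * L) := by ring
  linarith


/-- There exists a constant `C > 0` such that for all integers `a ≥ 1`, `b ≥ 1`, `u ≥ 4`
with `a + b ≤ u`, there exists a nonempty family `𝕊` of subsets of `{1, …, u}` with
`log₂ |𝕊| ≤ C * (log₂ log₂ u + log₂ (a+b choose a))` such that every pair of disjoint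
sets `A, B ⊆ {1, …, u}` with `|A| ≤ a`, `|B| ≤ b` is separated by some `S ∈ 𝕊`
(`A ⊆ S` and `B ∩ S = ∅`). -/
theorem separator_family_exists :
    ∃ C : ℝ, 0 < C ∧
      ∀ a b u : ℕ, 1 ≤ a → 1 ≤ b → 4 ≤ u → a + b ≤ u →
        ∃ 𝕊 : Finset (Finset ℕ), 𝕊.Nonempty ∧
          (∀ S ∈ 𝕊, S ⊆ Finset.Icc 1 u) ∧
          Real.logb 2 (𝕊.card : ℝ) ≤
            C * (Real.logb 2 (Real.logb 2 (u : ℝ)) +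
                 Real.logb 2 (((a + b).choose a : ℝ))) ∧
          ∀ A B : Finset ℕ, A ⊆ Finset.Icc 1 u → B ⊆ Finset.Icc 1 u →
            Disjoint A B → A.card ≤ a → B.card ≤ b →
              ∃ S ∈ 𝕊, A ⊆ S ∧ Disjoint B S := by
  classical
  refine ⟨5, by norm_num, ?_⟩
  intro a b u ha hb hu hab
  set U := Finset.Icc 1 u with hU
  have hUc : U.card = u := by simp [hU]
  set c := (a + b).choose a with hcdef
  have hcn : a + b ≤ c := le_choose_aux a b ha hb
  have hcnR : ((a + b : ℕ) : ℝ) ≤ (c : ℝ) := by exact_mod_cast hcn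
  have hn2 : (2 : ℝ) ≤ ((a + b : ℕ) : ℝ) := by exact_mod_cast (by omega : 2 ≤ a + b)
  have hu4 : (4 : ℝ) ≤ u := by exact_mod_cast hu
  set L := Real.logb 2 (u : ℝ) with hL
  have hL2 : 2 ≤ L := by
    rw [hL, Real.le_logb_iff_rpow_le (by norm_num) (by linarith)]
    norm_num; exact hu
  have hlog0 : 0 ≤ Real.log u := Real.log_nonneg (by linarith)
  have hlogL : Real.log u ≤ L := by
    rw [hL, Real.logb, le_div_iff₀ (Real.log_pos (by norm_num))]
    have : Real.log 2 ≤ 1 := by linarith [Real.log_two_lt_d9]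
    nlinarith
  set D : ℝ := (((a + b : ℕ) : ℝ) + 1) * c with hD
  have hD1 : 1 ≤ D := by nlinarith
  have hD0 : 0 < D := by linarith
  set t := ⌈D * (((a + b : ℕ) : ℝ) * Real.log u)⌉₊ + 1 with ht
  have htle : (t : ℝ) ≤ (c : ℝ) ^ 5 * L := numeric c _ L u hn2 hcnR hL2 hlogL hlog0
  let R : (U → Fin (a + b)) → (Finset ℕ × Finset ℕ) → Prop := fun f p =>
    p.1 ⊆ colSet a (a + b) U f ∧ Disjoint p.2 (colSet a (a + b) U f)
  let Q : Finset (Finset ℕ × Finset ℕ) :=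
    ((U.powersetCard a) ×ˢ (U.powersetCard b)).filter (fun p => Disjoint p.1 p.2)
  have hΩ : Fintype.card (U → Fin (a + b)) = (a + b) ^ u := by simp [hUc]
  have hQc : (Q.card : ℝ) ≤ (u : ℝ) ^ (a + b) := by
    have : Q.card ≤ u ^ (a + b) := by
      refine (Finset.card_filter_le _ _).trans ?_
      rw [Finset.card_product, Finset.card_powersetCard, Finset.card_powersetCard, hUc, pow_add]
      exact Nat.mul_le_mul (Nat.choose_le_pow _ _) (Nat.choose_le_pow _ _)
    exact_mod_cast this
  obtain ⟨T, hTc, hT⟩ := greedy_cover R Q D hD1 (by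
    rintro ⟨A, B⟩ hp
    simp only [Q, Finset.mem_filter, Finset.mem_product, Finset.mem_powersetCard] at hp
    obtain ⟨⟨⟨hA, hAc⟩, hB, hBc⟩, hdis⟩ := hp
    have h1 := count_col a b U A B hA hB hdis hAc hBc
    have h2 := pow_le_choose a b hb
    rw [hΩ, hD]
    rw [hUc] at h1
    have h3 : (a + b) ^ u ≤ (a + b + 1) * c * (Finset.univ.filter (fun w => R w (A, B))).card := by
      calc (a + b) ^ u = (a + b) ^ (a + b) * (a + b) ^ (u - (a + b)) := by
            rw [← pow_add]; congr 1; omega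
        _ ≤ ((a + b + 1) * c * (a ^ a * b ^ b)) * (a + b) ^ (u - (a + b)) :=
            Nat.mul_le_mul_right _ h2
        _ = (a + b + 1) * c * (a ^ a * b ^ b * (a + b) ^ (u - (a + b))) := by ring
        _ ≤ _ := by
            apply Nat.mul_le_mul_left
            convert h1
    exact_mod_cast h3) (by rw [hΩ]; apply pow_pos; omega) t
  have hlt : (Q.card : ℝ) * (1 - 1 / D) ^ t < 1 := by
    have e1 : (1 - 1 / D) ^ t ≤ Real.exp (-(t / D)) := by
      have : (1 - 1 / D) ≤ Real.exp (-(1 / D)) := by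
        have := Real.add_one_le_exp (-(1 / D)); linarith
      have hq : 0 ≤ 1 - 1 / D := by
        rw [sub_nonneg, div_le_one hD0]; exact hD1
      calc _ ≤ (Real.exp (-(1 / D))) ^ t := by gcongr
        _ = _ := by rw [← Real.exp_nat_mul]; congr 1; ring
    have e2 : (u : ℝ) ^ (a + b) = Real.exp (((a + b : ℕ) : ℝ) * Real.log u) := by
      rw [Real.exp_nat_mul, Real.exp_log (by linarith)]
    have e3 : ((a + b : ℕ) : ℝ) * Real.log u < t / D := by
      rw [lt_div_iff₀ hD0, ht]
      have := Nat.le_ceil (D * (((a + b : ℕ) : ℝ) * Real.log u))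
      push_cast at this ⊢
      linarith
    calc _ ≤ (u : ℝ) ^ (a + b) * Real.exp (-(t / D)) := by
          refine mul_le_mul hQc e1 (pow_nonneg ?_ _) (by positivity)
          rw [sub_nonneg, div_le_one hD0]; exact hD1
      _ = Real.exp (((a + b : ℕ) : ℝ) * Real.log u + -(t / D)) := by rw [e2, Real.exp_add]
      _ < 1 := by rw [Real.exp_lt_one_iff]; linarith
  have hempty : Q.filter (fun p => ∀ w ∈ T, ¬ R w p) = ∅ := by
    rw [← Finset.card_eq_zero]
    have := lt_of_le_of_lt hT hlt
    have : (Q.filter (fun p => ∀ w ∈ T, ¬ R w p)).card < 1 := by exact_mod_cast this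
    omega
  have hsep : ∀ A B : Finset ℕ, A ⊆ U → B ⊆ U →
            Disjoint A B → A.card ≤ a → B.card ≤ b →
              ∃ S ∈ T.image (colSet a (a + b) U), A ⊆ S ∧ Disjoint B S := by
    intro A B hA hB hdis hAc hBc
    obtain ⟨A', hAA', hA'U, hA'c⟩ := Finset.exists_subsuperset_card_eq
      (s := A) (t := U \ B) (n := a) (Finset.subset_sdiff.2 ⟨hA, hdis⟩) hAc
      (by rw [Finset.card_sdiff_of_subset hB, hUc]; omega)
    rw [Finset.subset_sdiff] at hA'U
    obtain ⟨B', hBB', hB'U, hB'c⟩ := Finset.exists_subsuperset_card_eq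
      (s := B) (t := U \ A') (n := b) (Finset.subset_sdiff.2 ⟨hB, hA'U.2.symm⟩) hBc
      (by rw [Finset.card_sdiff_of_subset hA'U.1, hUc]; omega)
    rw [Finset.subset_sdiff] at hB'U
    have hmem : (A', B') ∈ Q := by
      simp only [Q, Finset.mem_filter, Finset.mem_product, Finset.mem_powersetCard]
      exact ⟨⟨⟨hA'U.1, hA'c⟩, hB'U.1, hB'c⟩, hB'U.2.symm⟩
    have : (A', B') ∉ Q.filter (fun p => ∀ w ∈ T, ¬ R w p) := by rw [hempty]; simp
    rw [Finset.mem_filter] at this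
    push Not at this
    obtain ⟨w, hw, hR⟩ := this hmem
    exact ⟨_, Finset.mem_image_of_mem _ hw, hAA'.trans hR.1,
      Finset.disjoint_of_subset_left hBB' hR.2⟩
  have hne : (T.image (colSet a (a + b) U)).Nonempty := by
    obtain ⟨S, hS, _⟩ := hsep ∅ ∅ (by simp) (by simp) (by simp) (by simp) (by simp)
    exact ⟨S, hS⟩
  refine ⟨T.image (colSet a (a + b) U), hne, ?_, ?_, hsep⟩
  · intro S hS
    obtain ⟨f, _, rfl⟩ := Finset.mem_image.1 hS
    intro x hx
    simp only [colSet, Finset.mem_map] at hx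
    obtain ⟨y, _, rfl⟩ := hx
    exact y.2
  · have hc0 : (0 : ℝ) < c := by linarith
    have hcardle : ((T.image (colSet a (a + b) U)).card : ℝ) ≤ (c : ℝ) ^ 5 * L := by
      refine le_trans ?_ htle
      exact_mod_cast Finset.card_image_le.trans hTc
    have hpos : (0 : ℝ) < ((T.image (colSet a (a + b) U)).card : ℝ) := by
      exact_mod_cast Finset.card_pos.2 hne
    have h1 := Real.logb_le_logb_of_le (b := 2) (by norm_num) hpos hcardle
    rw [Real.logb_mul (by positivity) (by positivity), Real.logb_pow] at h1
    have h2 : 0 ≤ Real.logb 2 L := Real.logb_nonneg (by norm_num) (by linarith)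
    push_cast at h1
    linarith
end

section
/- For all integers a ≥ 1, b ≥ 1, and u ≥ 2 with a + b ≤ u, there exists a family 𝕊 of subsets of {1, 2, …, u} with |𝕊| ≤ ⌊(a+b)^(a+b+1) · ln u / (a^a · b^b)⌋ + 1 such that for every pair of disjoint sets A, B ⊆ {1, 2, …, u} with |A| ≤ a and |B| ≤ b, there exists S ∈ 𝕊 satisfying A ⊆ S and B ∩ S = ∅. -/
lemma sep_weight (U A B : Finset ℕ) (hA : A ⊆ U) (hB : B ⊆ U) (hAB : Disjoint A B)
    (p q : ℝ) (hpq : p + q = 1) :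
    (∑ S ∈ U.powerset, if A ⊆ S ∧ Disjoint B S then p ^ S.card * q ^ (U \ S).card else 0)
      = p ^ A.card * q ^ B.card := by
  have h := Finset.prod_add (fun i => if i ∈ B then (0 : ℝ) else p)
    (fun i => if i ∈ A then (0 : ℝ) else q) U
  have h1 : ∀ S ∈ U.powerset,
      (∏ i ∈ S, if i ∈ B then (0 : ℝ) else p) * (∏ i ∈ U \ S, if i ∈ A then (0 : ℝ) else q)
      = if A ⊆ S ∧ Disjoint B S then p ^ S.card * q ^ (U \ S).card else 0 := by
    intro S hS
    split_ifs with hc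
    · obtain ⟨hAS, hBS⟩ := hc
      congr 1
      · rw [← Finset.prod_const]
        refine Finset.prod_congr rfl fun i hi => ?_
        rw [if_neg (fun hb => Finset.disjoint_left.1 hBS hb hi)]
      · rw [← Finset.prod_const]
        refine Finset.prod_congr rfl fun i hi => ?_
        rw [if_neg (fun hb => (Finset.mem_sdiff.1 hi).2 (hAS hb))]
    · by_cases hAS : A ⊆ S
      · have hBS : ¬ Disjoint B S := fun h => hc ⟨hAS, h⟩
        obtain ⟨i, hiB, hiS⟩ := Finset.not_disjoint_iff.1 hBS
        rw [Finset.prod_eq_zero hiS (by simp [hiB]), zero_mul]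
      · obtain ⟨i, hiA, hiS⟩ := Finset.not_subset.1 hAS
        rw [Finset.prod_eq_zero (i := i) (s := U \ S)
          (Finset.mem_sdiff.2 ⟨hA hiA, hiS⟩) (by simp [hiA]), mul_zero]
  rw [Finset.sum_congr rfl h1] at h
  rw [← h]
  have h2 : ∀ i ∈ U, ((if i ∈ B then (0 : ℝ) else p) + (if i ∈ A then (0 : ℝ) else q))
      = (if i ∈ A then p else 1) * (if i ∈ B then q else 1) := by
    intro i _
    by_cases hiA : i ∈ A
    · have hiB : i ∉ B := Finset.disjoint_left.1 hAB hiA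
      simp [hiA, hiB]
    · by_cases hiB : i ∈ B <;> simp [hiA, hiB, hpq]
  rw [Finset.prod_congr rfl h2, Finset.prod_mul_distrib, Finset.prod_ite_mem,
    Finset.prod_ite_mem, Finset.inter_eq_right.2 hA, Finset.inter_eq_right.2 hB,
    Finset.prod_const, Finset.prod_const]

open Classical in
lemma sep_greedy {ι κ : Type*} (P : Finset ι) (Ω : Finset κ) (w : κ → ℝ) (R : ι → κ → Prop)
    (hw : ∀ S ∈ Ω, 0 < w S) (hw1 : ∑ S ∈ Ω, w S = 1) (c : ℝ) (hc1 : c ≤ 1)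
    (hc : ∀ x ∈ P, c ≤ ∑ S ∈ Ω, if R x S then w S else 0) (t : ℕ) :
    ∃ F : Finset κ, F ⊆ Ω ∧ F.card ≤ t ∧
      (((P.filter fun x => ∀ S ∈ F, ¬ R x S).card : ℕ) : ℝ) ≤ (1 - c) ^ t * P.card := by
  induction t with
  | zero => exact ⟨∅, by simp, by simp, by simp⟩
  | succ t ih =>
    obtain ⟨F, hF, hFc, hFP⟩ := ih
    set Q := P.filter fun x => ∀ S ∈ F, ¬ R x S with hQ
    have hne : Ω.Nonempty := by
      rw [Finset.nonempty_iff_ne_empty]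
      rintro rfl
      simp at hw1
    have key : ∑ S ∈ Ω, w S * ((Q.filter fun x => ¬ R x S).card : ℝ)
        ≤ ∑ S ∈ Ω, w S * ((1 - c) * Q.card) := by
      rw [← Finset.sum_mul, hw1, one_mul]
      have e : ∀ S ∈ Ω, w S * ((Q.filter fun x => ¬ R x S).card : ℝ)
          = ∑ x ∈ Q, (w S - if R x S then w S else 0) := by
        intro S _
        rw [Finset.card_filter, Nat.cast_sum, Finset.mul_sum]
        refine Finset.sum_congr rfl fun x _ => ?_
        by_cases h : R x S <;> simp [h]
      rw [Finset.sum_congr rfl e, Finset.sum_comm]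
      calc _ ≤ ∑ x ∈ Q, (1 - c) := by
            refine Finset.sum_le_sum fun x hx => ?_
            rw [Finset.sum_sub_distrib, hw1]
            have := hc x (Finset.mem_filter.1 hx).1
            linarith
        _ = (1 - c) * Q.card := by rw [Finset.sum_const, nsmul_eq_mul, mul_comm]
    obtain ⟨S, hS, hSle⟩ := Finset.exists_le_of_sum_le hne key
    have hSle2 := le_of_mul_le_mul_left hSle (hw S hS)
    refine ⟨insert S F, Finset.insert_subset hS hF,
      (Finset.card_insert_le _ _).trans (by omega), ?_⟩
    have e : (P.filter fun x => ∀ T ∈ insert S F, ¬ R x T) = Q.filter fun x => ¬ R x S := by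
      ext x
      simp only [hQ, Finset.mem_filter, Finset.mem_insert, forall_eq_or_imp]
      tauto
    rw [e]
    calc _ ≤ _ := hSle2
      _ ≤ (1 - c) * ((1 - c) ^ t * P.card) :=
        mul_le_mul_of_nonneg_left hFP (by linarith)
      _ = _ := by ring

lemma sep_greedy_cover {ι κ : Type*} (P : Finset ι) (Ω : Finset κ) (w : κ → ℝ) (R : ι → κ → Prop)
    [∀ x S, Decidable (R x S)]
    (hw : ∀ S ∈ Ω, 0 < w S) (hw1 : ∑ S ∈ Ω, w S = 1) (c : ℝ) (hc1 : c ≤ 1)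
    (hc : ∀ x ∈ P, c ≤ ∑ S ∈ Ω, if R x S then w S else 0) (t : ℕ)
    (hlt : (1 - c) ^ t * (P.card : ℝ) < 1) :
    ∃ F : Finset κ, F ⊆ Ω ∧ F.card ≤ t ∧ ∀ x ∈ P, ∃ S ∈ F, R x S := by
  classical
  obtain ⟨F, hF, hFc, hFP⟩ := sep_greedy P Ω w R hw hw1 c hc1
    (fun x hx => by convert hc x hx) t
  refine ⟨F, hF, hFc, fun x hx => ?_⟩
  by_contra hcon
  have h0 := hFP.trans_lt hlt
  rw [Nat.cast_lt_one, Finset.card_eq_zero] at h0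
  apply Finset.notMem_empty x
  rw [← h0]
  simp only [Finset.mem_filter]
  exact ⟨hx, fun S hS hR => hcon ⟨S, hS, hR⟩⟩

/-- For all integers `a ≥ 1`, `b ≥ 1`, `u ≥ 2` with `a + b ≤ u`, there exists a family `𝕊`
of subsets of `{1, …, u}` with `|𝕊| ≤ ⌊(a+b)^(a+b+1) · ln u / (a^a · b^b)⌋ + 1` such that
every pair of disjoint sets `A, B ⊆ {1, …, u}` with `|A| ≤ a`, `|B| ≤ b` is separated by
some `S ∈ 𝕊` (`A ⊆ S` and `B ∩ S = ∅`). -/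
theorem separator_family_size (a b u : ℕ) (ha : 1 ≤ a) (hb : 1 ≤ b) (hu : 2 ≤ u)
    (habu : a + b ≤ u) :
    ∃ 𝕊 : Finset (Finset ℕ),
      (∀ S ∈ 𝕊, S ⊆ Finset.Icc 1 u) ∧
      𝕊.card ≤ ⌊((a + b : ℝ) ^ (a + b + 1) * Real.log u / ((a : ℝ) ^ a * (b : ℝ) ^ b))⌋₊ + 1 ∧
      ∀ A B : Finset ℕ, A ⊆ Finset.Icc 1 u → B ⊆ Finset.Icc 1 u →
        Disjoint A B → A.card ≤ a → B.card ≤ b →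
          ∃ S ∈ 𝕊, A ⊆ S ∧ Disjoint B S := by
  classical
  set U := Finset.Icc 1 u with hU
  have hUc : U.card = u := by simp [hU]
  have ha0 : (0 : ℝ) < a := by exact_mod_cast ha
  have hb0 : (0 : ℝ) < b := by exact_mod_cast hb
  have hu0 : (0 : ℝ) < u := by exact_mod_cast (by omega : 0 < u)
  set p : ℝ := a / (a + b) with hp
  set q : ℝ := b / (a + b) with hq
  have hp0 : 0 < p := by positivity
  have hq0 : 0 < q := by positivity
  have hpq : p + q = 1 := by rw [hp, hq]; field_simp
  set c : ℝ := p ^ a * q ^ b with hc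
  have hc0 : 0 < c := by positivity
  have hc1 : c ≤ 1 :=
    mul_le_one₀ (pow_le_one₀ hp0.le (by linarith)) (by positivity)
      (pow_le_one₀ hq0.le (by linarith))
  set X : ℝ := (a + b : ℝ) ^ (a + b + 1) * Real.log u / ((a : ℝ) ^ a * (b : ℝ) ^ b) with hX
  have hcX : c * X = (a + b) * Real.log u := by
    rw [hc, hX, hp, hq, div_pow, div_pow]
    field_simp
    ring
  set t := ⌊X⌋₊ + 1 with ht
  have hXt : X < t := by rw [ht]; push_cast; exact Nat.lt_floor_add_one X
  set P := ((U.powersetCard a) ×ˢ (U.powersetCard b)).filter fun x => Disjoint x.1 x.2 with hP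
  have hPc : (P.card : ℝ) ≤ (u : ℝ) ^ (a + b) := by
    have : P.card ≤ u ^ (a + b) := by
      refine (Finset.card_filter_le _ _).trans ?_
      rw [Finset.card_product, Finset.card_powersetCard, Finset.card_powersetCard, hUc, pow_add]
      exact Nat.mul_le_mul (Nat.choose_le_pow _ _) (Nat.choose_le_pow _ _)
    exact_mod_cast this
  have hw1 : ∑ S ∈ U.powerset, p ^ S.card * q ^ (U \ S).card = 1 := by
    have := sep_weight U ∅ ∅ (by simp) (by simp) (by simp) p q hpq
    simpa using this
  have hlt : (1 - c) ^ t * (P.card : ℝ) < 1 := by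
    have h1 : (1 - c) ^ t ≤ Real.exp (-(c * t)) := by
      have := pow_le_pow_left₀ (by linarith : 0 ≤ 1 - c) (Real.one_sub_le_exp_neg c) t
      rw [← Real.exp_nat_mul] at this
      rw [show -(c * (t : ℝ)) = t * -c by ring]
      exact this
    have h2 : Real.exp (-(c * t)) < Real.exp (-((a + b) * Real.log u)) := by
      apply Real.exp_lt_exp.2
      rw [← hcX]
      have := mul_lt_mul_of_pos_left hXt hc0
      linarith
    have h3 : Real.exp (-((a + b) * Real.log u)) * (u : ℝ) ^ (a + b) = 1 := by
      have : (u : ℝ) ^ (a + b) = Real.exp ((a + b) * Real.log u) := by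
        have := Real.exp_nat_mul (Real.log u) (a + b)
        rw [Real.exp_log hu0] at this
        rw [← this]; push_cast; rfl
      rw [this, ← Real.exp_add]; simp
    have hup : (0 : ℝ) < (u : ℝ) ^ (a + b) := by positivity
    calc (1 - c) ^ t * (P.card : ℝ) ≤ (1 - c) ^ t * (u : ℝ) ^ (a + b) :=
          mul_le_mul_of_nonneg_left hPc (pow_nonneg (by linarith) _)
      _ < Real.exp (-((a + b) * Real.log u)) * (u : ℝ) ^ (a + b) :=
          mul_lt_mul_of_pos_right (h1.trans_lt h2) hup
      _ = 1 := h3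
  obtain ⟨F, hF, hFc, hzero⟩ := sep_greedy_cover P U.powerset
    (fun S => p ^ S.card * q ^ (U \ S).card)
    (fun x S => x.1 ⊆ S ∧ Disjoint x.2 S) (fun S _ => by positivity) hw1 c hc1
    (by
      intro x hx
      simp only [hP, Finset.mem_filter, Finset.mem_product, Finset.mem_powersetCard] at hx
      obtain ⟨⟨⟨h1, h2⟩, h3, h4⟩, h5⟩ := hx
      have := sep_weight U x.1 x.2 h1 h3 h5 p q hpq
      rw [h2, h4] at this
      rw [hc, ← this]) t hlt
  refine ⟨F, fun S hS => Finset.mem_powerset.1 (hF hS), hFc, ?_⟩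
  intro A B hA hB hAB hAc hBc
  obtain ⟨A2, hAA2, hA2U, hA2c⟩ := Finset.exists_subsuperset_card_eq
    (s := A) (t := U \ B) (n := a) (Finset.subset_sdiff.2 ⟨hA, hAB⟩) hAc
    (by rw [Finset.card_sdiff_of_subset hB, hUc]; omega)
  obtain ⟨hA2U, hA2B⟩ := Finset.subset_sdiff.1 hA2U
  obtain ⟨B2, hBB2, hB2U, hB2c⟩ := Finset.exists_subsuperset_card_eq
    (s := B) (t := U \ A2) (n := b) (Finset.subset_sdiff.2 ⟨hB, hA2B.symm⟩) hBc
    (by rw [Finset.card_sdiff_of_subset hA2U, hUc]; omega)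
  obtain ⟨hB2U, hB2A⟩ := Finset.subset_sdiff.1 hB2U
  have hmem : (A2, B2) ∈ P := by
    simp only [hP, Finset.mem_filter, Finset.mem_product, Finset.mem_powersetCard]
    exact ⟨⟨⟨hA2U, hA2c⟩, hB2U, hB2c⟩, hB2A.symm⟩
  obtain ⟨S, hS, h1, h2⟩ := hzero _ hmem
  exact ⟨S, hS, hAA2.trans h1, h2.mono_left hBB2⟩
end

section
/- Let L ≥ 1 and n ≥ 8L² be integers, and let X_1, …, X_{2L} be independent random variables each uniformly distributed on {1, …, n}. Set A = {X_1, …, X_L} and B = {X_{L+1}, …, X_{2L}} \ A. Then the expected interleaving number E[interleave(A, B)] ≥ L/4. -/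
/-- For disjoint finite sets `A, B ⊆ ℕ`, the interleaving number counts the elements
`x ∈ A` for which some `y ∈ B` satisfies `x < y` and no `x' ∈ A` has `x < x' < y`. -/
def interleave (A B : Finset ℕ) : ℕ :=
  (A.filter (fun x => ∃ y ∈ B, x < y ∧ ∀ x' ∈ A, ¬(x < x' ∧ x' < y))).card

/-- The good event for indices `i`, `j`. -/
def GoodPair {N : ℕ} (f : Fin N → ℕ) (i j : Fin N) : Prop :=
  f i < f j ∧ ∀ k, k ≠ i → k ≠ j → ¬ (f i ≤ f k ∧ f k ≤ f j)

open Classical in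
theorem good_le_interleave (L : ℕ) (f : Fin (2 * L) → ℕ) :
    (((Finset.univ.filter (fun i : Fin (2 * L) => (i : ℕ) < L)) ×ˢ
      (Finset.univ.filter (fun i : Fin (2 * L) => L ≤ (i : ℕ)))).filter
        (fun p => GoodPair f p.1 p.2)).card ≤
    interleave
      (Finset.image f (Finset.univ.filter (fun i : Fin (2 * L) => (i : ℕ) < L)))
      ((Finset.image f (Finset.univ.filter (fun i : Fin (2 * L) => L ≤ (i : ℕ)))) \
        (Finset.image f (Finset.univ.filter (fun i : Fin (2 * L) => (i : ℕ) < L)))) := by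
  unfold interleave
  apply Finset.card_le_card_of_injOn (fun p => f p.1)
  · rintro ⟨i, j⟩ h
    simp only [Finset.coe_filter, Finset.mem_product, Finset.mem_filter, Finset.mem_univ,
      true_and, Set.mem_setOf_eq] at h
    obtain ⟨⟨hi, hj⟩, hlt, hk⟩ := h
    simp only [Finset.coe_filter, Set.mem_setOf_eq, Finset.mem_image, Finset.mem_sdiff,
      Finset.mem_filter, Finset.mem_univ, true_and]
    refine ⟨⟨i, hi, rfl⟩, f j, ⟨⟨j, hj, rfl⟩, ?_⟩, hlt, ?_⟩
    · rintro ⟨k, hkL, hkj⟩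
      refine hk k ?_ ?_ ⟨by omega, by omega⟩
      · rintro rfl; omega
      · rintro rfl; omega
    · rintro _ ⟨k, hkL, rfl⟩ ⟨h1, h2⟩
      refine hk k ?_ ?_ ⟨by omega, by omega⟩
      · rintro rfl; omega
      · rintro rfl; omega
  · rintro ⟨i, j⟩ h ⟨i', j'⟩ h' heq
    simp only [Finset.coe_filter, Finset.mem_product, Finset.mem_filter, Finset.mem_univ,
      true_and, Set.mem_setOf_eq] at h h' heq
    obtain ⟨⟨hi, hj⟩, hlt, hk⟩ := h
    obtain ⟨⟨hi', hj'⟩, hlt', hk'⟩ := h'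
    have hii : i' = i := by
      by_contra hne
      refine hk i' hne ?_ ⟨by omega, by omega⟩
      rintro rfl; omega
    subst hii
    have hjj : j' = j := by
      by_contra hne
      rcases le_total (f j) (f j') with hle | hle
      · refine hk' j ?_ (Ne.symm hne) ⟨by omega, hle⟩
        rintro rfl; omega
      · refine hk j' ?_ hne ⟨by omega, hle⟩
        rintro rfl; omega
    rw [hjj]

/-- Box of functions with prescribed values at `i`, `j`, avoiding `[x,y]` elsewhere. -/
def boxSet (N n : ℕ) (i j : Fin N) (x y : ℕ) : Finset (Fin N → ℕ) :=
  Fintype.piFinset (fun k => if k = i then {x} else if k = j then {y}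
    else Finset.Icc 1 n \ Finset.Icc x y)

theorem boxSet_card (N n : ℕ) (i j : Fin N) (hij : i ≠ j) (m x : ℕ) (hm : m < n - 1)
    (hx : x ∈ Finset.Icc 1 (m + 1)) :
    (boxSet N n i j x (x + (n - 1 - m))).card = m ^ (N - 2) := by
  rw [Finset.mem_Icc] at hx
  have hc : (Finset.Icc 1 n \ Finset.Icc x (x + (n - 1 - m))).card = m := by
    rw [Finset.card_sdiff_of_subset]
    · simp only [Nat.card_Icc]; omega
    · apply Finset.Icc_subset_Icc <;> omega
  unfold boxSet
  rw [Fintype.card_piFinset, ← Finset.mul_prod_erase _ _ (Finset.mem_univ i),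
    ← Finset.mul_prod_erase _ _ (Finset.mem_erase.2 ⟨hij.symm, Finset.mem_univ j⟩)]
  rw [Finset.prod_congr rfl (g := fun _ => m)]
  · rw [Finset.prod_const, Finset.card_erase_of_mem (Finset.mem_erase.2 ⟨hij.symm, Finset.mem_univ j⟩),
      Finset.card_erase_of_mem (Finset.mem_univ i)]
    simp [hij.symm, Nat.sub_sub]
  · intro k hk
    simp only [Finset.mem_erase, Finset.mem_univ, and_true] at hk
    rw [if_neg hk.2, if_neg hk.1, hc]

open Classical in
theorem count_good (N n : ℕ) (i j : Fin N) (hij : i ≠ j) :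
    ∑ m ∈ Finset.range (n - 1), (m + 1) * m ^ (N - 2) ≤
    ((Fintype.piFinset (fun _ : Fin N => Finset.Icc 1 n)).filter
      (fun f => GoodPair f i j)).card := by
  have key : ((Finset.range (n - 1)).sigma (fun m => Finset.Icc 1 (m + 1))).sum
      (fun p => (boxSet N n i j p.2 (p.2 + (n - 1 - p.1))).card) =
      ∑ m ∈ Finset.range (n - 1), (m + 1) * m ^ (N - 2) := by
    rw [Finset.sum_sigma]
    apply Finset.sum_congr rfl
    intro m hm
    rw [Finset.sum_congr rfl (fun x hx => boxSet_card N n i j hij m x (Finset.mem_range.1 hm) hx)]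
    simp
  have hbox : ∀ f x y, f ∈ boxSet N n i j x y → f i = x ∧ f j = y ∧
      ∀ k, k ≠ i → k ≠ j → f k ∈ Finset.Icc 1 n \ Finset.Icc x y := by
    intro f x y hf
    rw [boxSet, Fintype.mem_piFinset] at hf
    refine ⟨?_, ?_, ?_⟩
    · simpa using hf i
    · simpa [hij.symm] using hf j
    · intro k h1 h2
      have := hf k
      rwa [if_neg h1, if_neg h2] at this
  rw [← key, ← Finset.card_biUnion]
  · apply Finset.card_le_card
    intro f hf
    simp only [Finset.mem_biUnion, Finset.mem_sigma, Finset.mem_range, Finset.mem_Icc] at hf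
    obtain ⟨⟨m, x⟩, ⟨hm, hx⟩, hf⟩ := hf
    obtain ⟨h1, h2, h3⟩ := hbox _ _ _ hf
    simp only at hm hx h1 h2 h3
    rw [Finset.mem_filter, Fintype.mem_piFinset]
    refine ⟨?_, ?_, ?_⟩
    · intro k
      by_cases hki : k = i
      · subst hki; rw [Finset.mem_Icc]; omega
      by_cases hkj : k = j
      · subst hkj; rw [Finset.mem_Icc]; omega
      exact (Finset.mem_sdiff.1 (h3 k hki hkj)).1
    · omega
    · intro k hki hkj hh
      apply (Finset.mem_sdiff.1 (h3 k hki hkj)).2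
      rw [Finset.mem_Icc]; omega
  · rintro ⟨m, x⟩ hp ⟨m', x'⟩ hp' hne
    refine Finset.disjoint_left.2 ?_
    intro f hf hf'
    simp only [Finset.mem_sigma, Finset.mem_range, Finset.mem_Icc, Finset.coe_sigma, Set.mem_sigma_iff, Finset.mem_coe] at hp hp'
    obtain ⟨h1, h2, -⟩ := hbox _ _ _ hf
    obtain ⟨h1', h2', -⟩ := hbox _ _ _ hf'
    simp only at h1 h2 h1' h2'
    apply hne
    have e1 : m = m' := by omega
    have e2 : x = x' := by omega
    rw [e1, e2]

theorem pow_le_sum (k M : ℕ) :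
    ((M : ℝ)) ^ (k + 1) ≤ (k + 1) * ∑ m ∈ Finset.range (M + 1), (m : ℝ) ^ k := by
  induction M with
  | zero => simp; positivity
  | succ M ih =>
    rw [Finset.sum_range_succ, mul_add]
    have hb : ((M + 1 : ℕ) : ℝ) ^ (k + 1) - (M : ℝ) ^ (k + 1) ≤
        (k + 1) * ((M + 1 : ℕ) : ℝ) ^ k := by
      have hpos : (0 : ℝ) < (M : ℝ) + 1 := by positivity
      have h := one_add_mul_le_pow (a := -(1 / ((M : ℝ) + 1))) (by
        have : 1 / ((M : ℝ) + 1) ≤ 1 := by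
          rw [div_le_one hpos]; linarith [Nat.cast_nonneg (α := ℝ) M]
        linarith) (k + 1)
      have e : 1 + -(1 / ((M : ℝ) + 1)) = M / (M + 1) := by field_simp; ring
      rw [e, div_pow, le_div_iff₀ (by positivity)] at h
      have e2 : (1 + ((k + 1 : ℕ) : ℝ) * -(1 / ((M : ℝ) + 1))) * ((M : ℝ) + 1) ^ (k + 1) =
          ((M : ℝ) + 1) ^ (k + 1) - (k + 1) * ((M : ℝ) + 1) ^ k := by
        push_cast; rw [pow_succ]; field_simp; ring
      rw [e2] at h
      push_cast
      linarith
    linarith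

/-- Let `L ≥ 1`, `n ≥ 8 L²`, and let `X_1, …, X_{2L}` be independent and uniform on
`{1, …, n}` (modeled as a uniformly random function `f : Fin (2L) → {1, …, n}`).
With `A = {X_1, …, X_L}` and `B = {X_{L+1}, …, X_{2L}} \ A`, the expected interleaving
number satisfies `E[interleave(A, B)] ≥ L / 4`. -/
theorem expected_interleaving (L n : ℕ) (hL : 1 ≤ L) (hn : 8 * L ^ 2 ≤ n) :
    (L : ℝ) / 4 ≤
      (∑ f ∈ Fintype.piFinset (fun _ : Fin (2 * L) => Finset.Icc 1 n),
          (interleave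
              (Finset.image f (Finset.univ.filter (fun i : Fin (2 * L) => (i : ℕ) < L)))
              ((Finset.image f (Finset.univ.filter (fun i : Fin (2 * L) => L ≤ (i : ℕ)))) \
                (Finset.image f (Finset.univ.filter (fun i : Fin (2 * L) => (i : ℕ) < L)))) : ℝ)) /
        ((Fintype.piFinset (fun _ : Fin (2 * L) => Finset.Icc 1 n)).card : ℝ) := by
  classical
  set I := Finset.univ.filter (fun i : Fin (2 * L) => (i : ℕ) < L) with hI
  set J := Finset.univ.filter (fun i : Fin (2 * L) => L ≤ (i : ℕ)) with hJ
  set P := Fintype.piFinset (fun _ : Fin (2 * L) => Finset.Icc 1 n) with hP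
  have hn8 : 8 ≤ n := by nlinarith
  have hIc : I.card = L := by
    have e : I = (Finset.univ : Finset (Fin L)).map (Fin.castLEEmb (by omega : L ≤ 2 * L)) := by
      ext i
      simp only [hI, Finset.mem_filter, Finset.mem_univ, true_and, Finset.mem_map]
      constructor
      · intro h; exact ⟨⟨i, h⟩, rfl⟩
      · rintro ⟨a, rfl⟩; exact a.2
    rw [e]; simp
  have hJc : J.card = L := by
    have h := Finset.card_filter_add_card_filter_not (s := (Finset.univ : Finset (Fin (2 * L))))
      (fun i : Fin (2 * L) => (i : ℕ) < L)
    simp only [not_lt] at h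
    rw [← hI, ← hJ, hIc, Finset.card_univ, Fintype.card_fin] at h
    omega
  have hPc : P.card = n ^ (2 * L) := by simp [hP]
  set S := ∑ m ∈ Finset.range (n - 1), (m + 1) * m ^ (2 * L - 2) with hS
  have h1 : L * L * S ≤ ∑ f ∈ P, interleave (Finset.image f I)
      (Finset.image f J \ Finset.image f I) := by
    calc L * L * S = ∑ p ∈ I ×ˢ J, S := by simp [hIc, hJc]
      _ ≤ ∑ p ∈ I ×ˢ J, (P.filter (fun f => GoodPair f p.1 p.2)).card := by
        apply Finset.sum_le_sum
        rintro ⟨i, j⟩ hp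
        simp only [hI, hJ, Finset.mem_product, Finset.mem_filter, Finset.mem_univ, true_and] at hp
        apply count_good
        intro hij
        change i = j at hij
        rw [hij] at hp
        omega
      _ = ∑ f ∈ P, ((I ×ˢ J).filter (fun p => GoodPair f p.1 p.2)).card := by
        simp only [Finset.card_filter]
        exact Finset.sum_comm
      _ ≤ _ := Finset.sum_le_sum (fun f _ => good_le_interleave L f)
  have h2 : ((n : ℝ) - 2) ^ (2 * L) ≤ 2 * L * (S : ℝ) := by
    have h := pow_le_sum (2 * L - 1) (n - 2)
    have e1 : 2 * L - 1 + 1 = 2 * L := by omega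
    have e2 : n - 2 + 1 = n - 1 := by omega
    have e3 : ((2 * L - 1 : ℕ) : ℝ) + 1 = 2 * L := by exact_mod_cast e1
    rw [e1, e2, e3, Nat.cast_sub (by omega)] at h
    refine h.trans ?_
    apply mul_le_mul_of_nonneg_left _ (by positivity)
    rw [hS]
    push_cast
    apply Finset.sum_le_sum
    intro m _
    have e4 : 2 * L - 1 = (2 * L - 2) + 1 := by omega
    rw [e4, pow_succ, mul_comm]
    apply mul_le_mul_of_nonneg_right _ (by positivity)
    linarith
  have hn0 : (0 : ℝ) < n := by exact_mod_cast (by omega : 0 < n)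
  have hL1 : (1 : ℝ) ≤ L := by exact_mod_cast hL
  have hn' : 8 * (L : ℝ) ^ 2 ≤ n := by exact_mod_cast hn
  have h3 : (n : ℝ) ^ (2 * L) * (1 / 2) ≤ ((n : ℝ) - 2) ^ (2 * L) := by
    have hn8' : (8 : ℝ) ≤ n := by exact_mod_cast hn8
    have h := one_add_mul_le_pow (a := -(2 / (n : ℝ))) (by
      have : 2 / (n : ℝ) ≤ 1 := by rw [div_le_one hn0]; linarith
      linarith) (2 * L)
    have e : (n : ℝ) - 2 = n * (1 + -(2 / (n : ℝ))) := by field_simp; ring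
    rw [e, mul_pow]
    apply mul_le_mul_of_nonneg_left _ (by positivity)
    refine le_trans ?_ h
    have : 4 * (L : ℝ) / n ≤ 1 / 2 := by
      rw [div_le_iff₀ hn0]; nlinarith
    have e5 : ((2 * L : ℕ) : ℝ) * -(2 / (n : ℝ)) = - (4 * (L : ℝ) / n) := by push_cast; ring
    rw [e5]; linarith
  have h1' : (L : ℝ) * L * S ≤ ∑ f ∈ P, (interleave (Finset.image f I)
      (Finset.image f J \ Finset.image f I) : ℝ) := by exact_mod_cast h1
  rw [hPc, le_div_iff₀ (by push_cast; positivity)]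
  refine le_trans ?_ h1'
  push_cast
  have h4 := mul_le_mul_of_nonneg_left (h3.trans h2) (by positivity : (0 : ℝ) ≤ L / 2)
  calc (L : ℝ) / 4 * n ^ (2 * L) = L / 2 * (n ^ (2 * L) * (1 / 2)) := by ring
    _ ≤ _ := h4
    _ = _ := by ring
end

section
/- For all natural numbers m ≤ k, every j with 0 ≤ j < 2^{k−m}, and every t with 0 ≤ t < 2^m, the bit-reversal permutation satisfies rev_k(j·2^m + t) = rev_m(t)·2^{k−m} + rev_{k−m}(j). -/
/-- The bit-reversal permutation of order `2^k`: `i = Σ_{j<k} b_j 2^j` is sent to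
`Σ_{j<k} b_j 2^{k-1-j}`. -/
def rev (k i : ℕ) : ℕ :=
  ∑ j ∈ Finset.range k, if i.testBit j then 2 ^ (k - 1 - j) else 0

/-- For `m ≤ k`, `j < 2^{k-m}` and `t < 2^m`:
`rev_k(j·2^m + t) = rev_m(t)·2^{k-m} + rev_{k-m}(j)`. -/
theorem rev_split (m k j t : ℕ) (hmk : m ≤ k) (hj : j < 2 ^ (k - m)) (ht : t < 2 ^ m) :
    rev k (j * 2 ^ m + t) = rev m t * 2 ^ (k - m) + rev (k - m) j := by
  obtain ⟨d, rfl⟩ := Nat.exists_eq_add_of_le hmk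
  have hd : m + d - m = d := by omega
  rw [hd]
  unfold rev
  rw [Finset.sum_range_add, Finset.sum_mul, mul_comm j]
  congr 1
  · refine Finset.sum_congr rfl fun i hi => ?_
    have hi' := Finset.mem_range.mp hi
    rw [Nat.testBit_two_pow_mul_add _ ht, if_pos hi', ite_mul, zero_mul, ← pow_add]
    have h : m + d - 1 - i = m - 1 - i + d := by omega
    rw [h]
  · refine Finset.sum_congr rfl fun i hi => ?_
    have hi' := Finset.mem_range.mp hi
    have h : m + d - 1 - (m + i) = d - 1 - i := by omega
    rw [Nat.testBit_two_pow_mul_add _ ht, if_neg (show ¬ (m + i < m) by omega), Nat.add_sub_cancel_left, h]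
end

section
/- Let k ≥ 1, let 1 ≤ m ≤ k, and let 0 ≤ j < 2^{k−m}. Set r = rev_{k−m}(j) and d = 2^{k−m}. Then rev_k maps the left half {j·2^m + t : 0 ≤ t < 2^{m−1}} of the dyadic interval [j·2^m, (j+1)·2^m) bijectively onto {2s·d + r : 0 ≤ s < 2^{m−1}}, and maps the right half {j·2^m + t : 2^{m−1} ≤ t < 2^m} bijectively onto {(2s+1)·d + r : 0 ≤ s < 2^{m−1}}. In particular, an element x belongs to the image of the left half if and only if x + d belongs to the image of the right half, so the two image sets perfectly alternate. -/
theorem rev_append (m n j t : ℕ) (ht : t < 2 ^ m) :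
    rev (m + n) (j * 2 ^ m + t) = rev m t * 2 ^ n + rev n j := by
  unfold rev
  rw [Finset.sum_range_add, Finset.sum_mul]
  congr 1
  · apply Finset.sum_congr rfl
    intro i hi
    rw [Finset.mem_range] at hi
    rw [mul_comm j, Nat.testBit_two_pow_mul_add _ ht, if_pos hi, ite_mul, zero_mul, ← pow_add]
    congr 2
    omega
  · apply Finset.sum_congr rfl
    intro i hi
    rw [Finset.mem_range] at hi
    rw [mul_comm j, Nat.testBit_two_pow_mul_add _ ht, if_neg (show ¬ m + i < m by omega),
      Nat.add_sub_cancel_left]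
    congr 2
    omega

theorem rev_one (b : ℕ) (hb : b < 2) : rev 1 b = b := by
  unfold rev
  interval_cases b <;> decide

theorem rev_succ_low (p t : ℕ) (ht : t < 2 ^ p) : rev (p + 1) t = 2 * rev p t := by
  have h := rev_append p 1 0 t ht
  rw [rev_one 0 (by omega)] at h
  simp only [zero_mul, zero_add] at h
  omega

theorem rev_succ_high (p t : ℕ) (ht : t < 2 ^ p) :
    rev (p + 1) (2 ^ p + t) = 2 * rev p t + 1 := by
  have h := rev_append p 1 1 t ht
  rw [rev_one 1 (by omega)] at h
  simp only [one_mul] at h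
  omega

theorem rev_lt_inj (p : ℕ) : (∀ t < 2 ^ p, rev p t < 2 ^ p) ∧
    ∀ s < 2 ^ p, ∀ t < 2 ^ p, rev p s = rev p t → s = t := by
  induction p with
  | zero => simp [rev]
  | succ p ih =>
    obtain ⟨h1, h2⟩ := ih
    have key : ∀ t < 2 ^ (p + 1), (t < 2 ^ p ∧ rev (p + 1) t = 2 * rev p t) ∨
        ∃ u < 2 ^ p, t = 2 ^ p + u ∧ rev (p + 1) t = 2 * rev p u + 1 := by
      intro t ht
      rw [pow_succ] at ht
      by_cases h : t < 2 ^ p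
      · exact Or.inl ⟨h, rev_succ_low p t h⟩
      · right
        obtain ⟨u, rfl⟩ := Nat.exists_eq_add_of_le (not_lt.mp h)
        exact ⟨u, by omega, rfl, rev_succ_high p u (by omega)⟩
    constructor
    · intro t ht
      rw [pow_succ]
      rcases key t ht with ⟨h, e⟩ | ⟨u, h, -, e⟩
      · have := h1 t h
        omega
      · have := h1 u h
        omega
    · intro s hs t ht hst
      rcases key s hs with ⟨h, e⟩ | ⟨u, h, e', e⟩ <;>
        rcases key t ht with ⟨g, f⟩ | ⟨v, g, f', f⟩
      · exact h2 s h t g (by omega)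
      · omega
      · omega
      · have := h2 u h v g (by omega)
        omega

theorem rev_image (p : ℕ) :
    Finset.image (rev p) (Finset.range (2 ^ p)) = Finset.range (2 ^ p) := by
  obtain ⟨h1, h2⟩ := rev_lt_inj p
  apply Finset.eq_of_subset_of_card_le
  · intro x hx
    obtain ⟨t, ht, rfl⟩ := Finset.mem_image.mp hx
    exact Finset.mem_range.mpr (h1 t (Finset.mem_range.mp ht))
  · rw [Finset.card_image_of_injOn]
    intro s hs t ht h
    exact h2 s (by simpa using hs) t (by simpa using ht) h

/-- Let `1 ≤ m ≤ k` and `j < 2^{k-m}`, and set `r = rev_{k-m}(j)`, `d = 2^{k-m}`.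
Then `rev_k` maps the left half of the dyadic interval `[j·2^m, (j+1)·2^m)` bijectively
onto `{2s·d + r : s < 2^{m-1}}` (stated as: the map is injective on the interval, and the
image of the left half equals that set), maps the right half bijectively onto
`{(2s+1)·d + r : s < 2^{m-1}}`, and `x` is in the image of the left half iff `x + d` is
in the image of the right half, so the two image sets perfectly alternate. -/
theorem rev_dyadic_halves (k m j : ℕ) (hk : 1 ≤ k) (hm : 1 ≤ m) (hmk : m ≤ k)
    (hj : j < 2 ^ (k - m)) :
    Set.InjOn (fun t => rev k (j * 2 ^ m + t)) (Set.Iio (2 ^ m)) ∧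
    Finset.image (fun t => rev k (j * 2 ^ m + t)) (Finset.range (2 ^ (m - 1))) =
      Finset.image (fun s => 2 * s * 2 ^ (k - m) + rev (k - m) j)
        (Finset.range (2 ^ (m - 1))) ∧
    Finset.image (fun t => rev k (j * 2 ^ m + t)) (Finset.Ico (2 ^ (m - 1)) (2 ^ m)) =
      Finset.image (fun s => (2 * s + 1) * 2 ^ (k - m) + rev (k - m) j)
        (Finset.range (2 ^ (m - 1))) ∧
    ∀ x : ℕ,
      x ∈ Finset.image (fun t => rev k (j * 2 ^ m + t)) (Finset.range (2 ^ (m - 1))) ↔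
      x + 2 ^ (k - m) ∈
        Finset.image (fun t => rev k (j * 2 ^ m + t)) (Finset.Ico (2 ^ (m - 1)) (2 ^ m)) := by
  obtain ⟨n, rfl⟩ := Nat.exists_eq_add_of_le hmk
  obtain ⟨p, rfl⟩ := Nat.exists_eq_add_of_le' hm
  simp only [Nat.add_sub_cancel_left, Nat.add_sub_cancel] at *
  have hpos : 0 < 2 ^ n := by positivity
  have hp2 : 2 ^ (p + 1) = 2 ^ p + 2 ^ p := by rw [pow_succ]; omega
  have hL : Finset.image (fun t => rev (p + 1 + n) (j * 2 ^ (p + 1) + t))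
      (Finset.range (2 ^ p)) =
      Finset.image (fun s => 2 * s * 2 ^ n + rev n j) (Finset.range (2 ^ p)) := by
    conv_rhs => rw [← rev_image p, Finset.image_image]
    apply Finset.image_congr
    intro t ht
    have ht' : t < 2 ^ p := by simpa using ht
    simp only [Function.comp]
    rw [rev_append _ _ _ _ (by omega), rev_succ_low p t ht']
  have hR : Finset.image (fun t => rev (p + 1 + n) (j * 2 ^ (p + 1) + t))
      (Finset.Ico (2 ^ p) (2 ^ (p + 1))) =
      Finset.image (fun s => (2 * s + 1) * 2 ^ n + rev n j) (Finset.range (2 ^ p)) := by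
    have hI : Finset.Ico (2 ^ p) (2 ^ (p + 1)) =
        Finset.image (fun t => 2 ^ p + t) (Finset.range (2 ^ p)) := by
      ext x
      simp only [Finset.mem_Ico, Finset.mem_image, Finset.mem_range]
      constructor
      · intro h
        exact ⟨x - 2 ^ p, by omega, by omega⟩
      · rintro ⟨t, ht, rfl⟩
        omega
    conv_rhs => rw [← rev_image p, Finset.image_image]
    rw [hI, Finset.image_image]
    apply Finset.image_congr
    intro t ht
    have ht' : t < 2 ^ p := by simpa using ht
    simp only [Function.comp]
    rw [rev_append _ _ _ _ (by omega), rev_succ_high p t ht']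
  refine ⟨?_, hL, hR, ?_⟩
  · intro s hs t ht h
    simp only [Set.mem_Iio] at hs ht
    simp only [rev_append _ _ _ _ hs, rev_append _ _ _ _ ht] at h
    exact (rev_lt_inj (p + 1)).2 s hs t ht
      (Nat.eq_of_mul_eq_mul_right hpos (Nat.add_right_cancel h))
  · intro x
    rw [hL, hR]
    simp only [Finset.mem_image, Finset.mem_range]
    apply exists_congr
    intro s
    rw [add_mul, one_mul]
    apply and_congr_right
    intro _
    omega
end

section
/- Let k ≥ 1. For 1 ≤ m ≤ k and 0 ≤ j < 2^{k−m}, let L_{m,j} = rev_k({j·2^m + t : 0 ≤ t < 2^{m−1}}) and R_{m,j} = rev_k({j·2^m + t : 2^{m−1} ≤ t < 2^m}) be the images under the bit-reversal permutation of the left and right halves of the dyadic interval [j·2^m, (j+1)·2^m). Then Σ_{m=1}^{k} Σ_{j=0}^{2^{k−m}−1} interleave(L_{m,j}, R_{m,j}) = k·2^{k−1}; in particular, the total interleaving of the bit-reversal permutation of order n = 2^k is Θ(n log n). -/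
theorem rev_succ_top (n i : ℕ) :
    rev (n + 1) i = 2 * rev n i + if i.testBit n then 1 else 0 := by
  unfold rev
  rw [Finset.sum_range_succ, Finset.mul_sum]
  congr 1
  · apply Finset.sum_congr rfl
    intro j hj
    have hj := Finset.mem_range.1 hj
    have h : n + 1 - 1 - j = (n - 1 - j) + 1 := by omega
    rw [h, pow_succ]
    split_ifs <;> ring
  · simp

theorem rev_congr (n i j : ℕ) (h : ∀ l < n, i.testBit l = j.testBit l) : rev n i = rev n j := by
  unfold rev
  apply Finset.sum_congr rfl
  intro l hl
  rw [h l (Finset.mem_range.1 hl)]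

theorem rev_inj (n i j : ℕ) (h : rev n i = rev n j) : ∀ l < n, i.testBit l = j.testBit l := by
  induction n with
  | zero => intro l hl; omega
  | succ n ih =>
    rw [rev_succ_top, rev_succ_top] at h
    have h1 : rev n i = rev n j := by split_ifs at h <;> omega
    have h2 : i.testBit n = j.testBit n := by
      rw [h1] at h
      cases hi : i.testBit n <;> cases hj : j.testBit n <;> simp_all
    intro l hl
    rcases Nat.lt_succ_iff_lt_or_eq.1 hl with hl | rfl
    · exact ih h1 l hl
    · exact h2

theorem rev_add (a b i : ℕ) : rev (a + b) i = rev b (i / 2 ^ a) + 2 ^ b * rev a i := by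
  unfold rev
  rw [Finset.sum_range_add, Finset.mul_sum, add_comm]
  congr 1
  · apply Finset.sum_congr rfl
    intro j hj
    have hj := Finset.mem_range.1 hj
    have h : a + b - 1 - (a + j) = b - 1 - j := by omega
    rw [h, Nat.testBit_div_two_pow, add_comm a j]
  · apply Finset.sum_congr rfl
    intro j hj
    have hj := Finset.mem_range.1 hj
    have h : a + b - 1 - j = b + (a - 1 - j) := by omega
    rw [h, pow_add]
    split_ifs <;> simp

theorem rev_left (n d j t : ℕ) (ht : t < 2 ^ n) :
    rev (n + 1 + d) (j * 2 ^ (n + 1) + t) = rev d j + 2 ^ d * (2 * rev n t) := by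
  have hp : 2 ^ n < 2 ^ (n + 1) := Nat.pow_lt_pow_right (by norm_num) (by omega)
  rw [rev_add, mul_comm j, Nat.mul_add_div (by positivity), Nat.div_eq_of_lt (by omega), add_zero,
    rev_congr (n + 1) _ t, rev_succ_top, Nat.testBit_lt_two_pow ht]
  · simp
  · intro l hl
    rw [Nat.testBit_two_pow_mul_add _ (by omega), if_pos hl]

theorem rev_right (n d j t : ℕ) (ht : t < 2 ^ n) :
    rev (n + 1 + d) (j * 2 ^ (n + 1) + (2 ^ n + t)) = rev d j + 2 ^ d * (2 * rev n t + 1) := by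
  have hp : 2 ^ (n + 1) = 2 ^ n + 2 ^ n := by ring
  rw [rev_add, mul_comm j, Nat.mul_add_div (by positivity), Nat.div_eq_of_lt (by omega), add_zero,
    rev_congr (n + 1) _ (2 ^ n + t), rev_succ_top, rev_congr n (2 ^ n + t) t]
  · rw [Nat.testBit_two_pow_add_eq, Nat.testBit_lt_two_pow ht]; simp
  · intro l hl
    rw [Nat.testBit_two_pow_add_gt hl]
  · intro l hl
    rw [Nat.testBit_two_pow_mul_add _ (by omega), if_pos hl]

theorem interleave_block (n d j : ℕ) :
    interleave
      (Finset.image (fun t => rev (n + 1 + d) (j * 2 ^ (n + 1) + t)) (Finset.range (2 ^ n)))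
      (Finset.image (fun t => rev (n + 1 + d) (j * 2 ^ (n + 1) + t))
        (Finset.Ico (2 ^ n) (2 ^ (n + 1)))) = 2 ^ n := by
  have hd : 0 < 2 ^ d := by positivity
  unfold interleave
  rw [Finset.filter_true_of_mem, Finset.card_image_of_injOn, Finset.card_range]
  · intro s hs t ht h
    have hs : s < 2 ^ n := by simpa using hs
    have ht : t < 2 ^ n := by simpa using ht
    simp only [rev_left n d j s hs, rev_left n d j t ht] at h
    have h1 := Nat.eq_of_mul_eq_mul_left hd (Nat.add_left_cancel h)
    have h2 := rev_inj n s t (by omega)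
    apply Nat.eq_of_testBit_eq
    intro l
    by_cases hl : l < n
    · exact h2 l hl
    · have : 2 ^ n ≤ 2 ^ l := Nat.pow_le_pow_right (by norm_num) (by omega)
      rw [Nat.testBit_lt_two_pow (by omega), Nat.testBit_lt_two_pow (by omega)]
  · intro x hx
    obtain ⟨t, ht, rfl⟩ := Finset.mem_image.1 hx
    have ht := Finset.mem_range.1 ht
    have hp : 2 ^ (n + 1) = 2 ^ n + 2 ^ n := by ring
    refine ⟨_, Finset.mem_image_of_mem _ (a := 2 ^ n + t) (Finset.mem_Ico.2 ⟨by omega, by omega⟩),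
      ?_, ?_⟩
    · rw [rev_left n d j t ht, rev_right n d j t ht]
      gcongr
      omega
    · intro x' hx' h
      obtain ⟨s, hs, rfl⟩ := Finset.mem_image.1 hx'
      have hs := Finset.mem_range.1 hs
      simp only [rev_left n d j s hs, rev_left n d j t ht, rev_right n d j t ht] at h
      have h1 := Nat.lt_of_mul_lt_mul_left (Nat.lt_of_add_lt_add_left h.1)
      have h2 := Nat.lt_of_mul_lt_mul_left (Nat.lt_of_add_lt_add_left h.2)
      omega

/-- For `k ≥ 1`, summing the interleaving numbers of the images under the bit-reversal
permutation `rev_k` of the left and right halves of all dyadic intervals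
`[j·2^m, (j+1)·2^m)` (over `1 ≤ m ≤ k`, `0 ≤ j < 2^{k-m}`) gives exactly `k · 2^{k-1}`;
so the total interleaving of the bit-reversal permutation of order `n = 2^k`
is `Θ(n log n)`. -/
theorem bit_reversal_total_interleaving (k : ℕ) (hk : 1 ≤ k) :
    ∑ m ∈ Finset.Icc 1 k, ∑ j ∈ Finset.range (2 ^ (k - m)),
        interleave
          (Finset.image (fun t => rev k (j * 2 ^ m + t)) (Finset.range (2 ^ (m - 1))))
          (Finset.image (fun t => rev k (j * 2 ^ m + t)) (Finset.Ico (2 ^ (m - 1)) (2 ^ m)))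
      = k * 2 ^ (k - 1) := by
  have key : ∀ m ∈ Finset.Icc 1 k, ∑ j ∈ Finset.range (2 ^ (k - m)),
        interleave
          (Finset.image (fun t => rev k (j * 2 ^ m + t)) (Finset.range (2 ^ (m - 1))))
          (Finset.image (fun t => rev k (j * 2 ^ m + t)) (Finset.Ico (2 ^ (m - 1)) (2 ^ m)))
      = 2 ^ (k - 1) := by
    intro m hm
    obtain ⟨h1, h2⟩ := Finset.mem_Icc.1 hm
    obtain ⟨n, rfl⟩ : ∃ n, m = n + 1 := ⟨m - 1, by omega⟩
    obtain ⟨d, rfl⟩ : ∃ d, k = n + 1 + d := ⟨k - (n + 1), by omega⟩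
    have e1 : n + 1 - 1 = n := by omega
    have e2 : n + 1 + d - (n + 1) = d := by omega
    have e3 : n + 1 + d - 1 = d + n := by omega
    rw [e1, e2, e3, Finset.sum_congr rfl (fun j _ => interleave_block n d j)]
    simp [pow_add]
  rw [Finset.sum_congr rfl key]
  simp
end
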